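/- Let p, q > 1 with 1/p + 1/q = 1, and let α, β > 0 be real numbers with qα > 1 and pβ > 1. Then (∑_{k=1}^∞ (-1)^{k+1} k^{-qα})^{1/q} · (∑_{k=1}^∞ (-1)^{k+1} k^{-pβ})^{1/p} ≤ ∑_{k=1}^∞ (-1)^{k+1} k^{-(α+β)}. -/

import Mathlib

open Set
/-- chord -/
lemma chord (φ : ℝ → ℝ) (hφ : ConcaveOn ℝ (Ici 0) φ) (y1 y2 : ℝ) (h1 : 0 ≤ y1) (h : y1 < y2) :
    ∃ l m : ℝ, ∀ y, 0 ≤ y → ((y1 ≤ y → y ≤ y2 → l + m * y ≤ φ y) ∧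
      ((y ≤ y1 ∨ y2 ≤ y) → φ y ≤ l + m * y)) := by
  have hd : 0 < y2 - y1 := by linarith
  refine ⟨φ y1 - (φ y2 - φ y1) / (y2 - y1) * y1, (φ y2 - φ y1) / (y2 - y1), fun y hy => ⟨?_, ?_⟩⟩
  · intro a b
    have := hφ.2 (show y1 ∈ Ici (0 : ℝ) from h1) (show y2 ∈ Ici (0 : ℝ) by simp; linarith)
      (show 0 ≤ (y2 - y) / (y2 - y1) from div_nonneg (by linarith) hd.le)
      (show 0 ≤ (y - y1) / (y2 - y1) from div_nonneg (by linarith) hd.le) (by field_simp; ring)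
    have e : ((y2 - y) / (y2 - y1)) • y1 + ((y - y1) / (y2 - y1)) • y2 = y := by
      simp only [smul_eq_mul]; field_simp; ring
    rw [e] at this
    refine le_trans (le_of_eq ?_) this
    simp only [smul_eq_mul]; field_simp; ring
  · have key : φ y1 - (φ y2 - φ y1) / (y2 - y1) * y1 + (φ y2 - φ y1) / (y2 - y1) * y
        = φ y1 + (φ y2 - φ y1) / (y2 - y1) * (y - y1) := by ring
    rw [key]
    rintro (a | a)
    · rcases a.eq_or_lt with rfl | a
      · simp
      have := hφ.slope_anti_adjacent (x := y) (y := y1) (z := y2) hy (by simp; linarith) a h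
      rw [le_div_iff₀ (by linarith)] at this
      nlinarith
    · rcases a.eq_or_lt with rfl | a
      · field_simp; simp
      have := hφ.slope_anti_adjacent (x := y1) (y := y2) (z := y) h1 (by simp; linarith) h a
      rw [div_le_iff₀ (by linarith)] at this
      have e : (φ y2 - φ y1) / (y2 - y1) * (y2 - y1) = φ y2 - φ y1 := by field_simp
      nlinarith

lemma sep (d e : ℝ) (hd : 0 < d) (hde : d < e) (P : Set ℝ) (hP : OrdConnected P) (hP0 : P ⊆ Ioi 0)
    (hnt : P.Subsingleton → P = ∅) :
    ∃ l m : ℝ, ∀ x, 0 < x → ((x ∈ P → l + m * x ^ e ≤ x ^ d) ∧ (x ∉ P → x ^ d ≤ l + m * x ^ e)) := by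
  have he : 0 < e := by linarith
  rcases P.eq_empty_or_nonempty with rfl | hne
  · refine ⟨1, 1, fun x hx => ⟨by simp, fun _ => ?_⟩⟩
    rcases le_total x 1 with h | h
    · have := Real.rpow_le_one hx.le h hd.le
      have := Real.rpow_pos_of_pos hx e
      linarith
    · have := Real.rpow_le_rpow_of_exponent_le h hde.le
      linarith
  have hbb : BddBelow P := ⟨0, fun x hx => (hP0 hx).le⟩
  have h0 : 0 ≤ sInf P := le_csInf hne fun x hx => (hP0 hx).le
  by_cases hb : BddAbove P
  · have hlt : sInf P < sSup P := by
      have : P.Nontrivial := by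
        rw [← not_subsingleton_iff]; intro h; exact hne.ne_empty (hnt h)
      obtain ⟨x, hx, y, hy, hxy⟩ := this.exists_lt
      exact (csInf_le hbb hx).trans_lt (hxy.trans_le (le_csSup hb hy))
    obtain ⟨l, m, H⟩ := chord (fun y => y ^ (d / e)) (Real.concaveOn_rpow (by positivity)
      (by rw [div_le_one he]; exact hde.le)) (sInf P ^ e) (sSup P ^ e) (by positivity)
      (Real.rpow_lt_rpow h0 hlt he)
    refine ⟨l, m, fun x hx => ?_⟩
    have ex : (x ^ e) ^ (d / e) = x ^ d := by rw [← Real.rpow_mul hx.le]; congr 1; field_simp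
    obtain ⟨H1, H2⟩ := H (x ^ e) (by positivity)
    simp only [ex] at H1 H2
    refine ⟨fun h => H1 (Real.rpow_le_rpow h0 (csInf_le hbb h) he.le)
      (Real.rpow_le_rpow hx.le (le_csSup hb h) he.le), fun h => H2 ?_⟩
    by_contra! hc
    apply h
    have c1 : sInf P < x := by
      by_contra! h'; exact absurd (Real.rpow_le_rpow hx.le h' he.le) (not_le.2 hc.1)
    have c2 : x < sSup P := by
      by_contra! h'; exact absurd (Real.rpow_le_rpow (h0.trans hlt.le) h' he.le) (not_le.2 hc.2)
    obtain ⟨a, ha, hax⟩ := exists_lt_of_csInf_lt hne c1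
    obtain ⟨b, hb', hbx⟩ := exists_lt_of_lt_csSup hne c2
    exact hP.out ha hb' ⟨hax.le, hbx.le⟩
  · refine ⟨sInf P ^ d, 0, fun x hx => ⟨fun h => ?_, fun h => ?_⟩⟩
    · simpa using Real.rpow_le_rpow h0 (csInf_le hbb h) hd.le
    · simp only [zero_mul, add_zero]
      refine Real.rpow_le_rpow hx.le ?_ hd.le
      by_contra! c1
      apply h
      obtain ⟨a, ha, hax⟩ := exists_lt_of_csInf_lt hne c1
      obtain ⟨b, hb', hbx⟩ := not_bddAbove_iff.1 hb x
      exact hP.out ha hb' ⟨hax.le, hbx.le⟩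

open MeasureTheory

/-- The eta function as a normalized moment. -/
noncomputable def etaI (s : ℝ) : ℝ := ∫ x in Ioi (0 : ℝ), x ^ (s - 1) * (1 / (Real.exp x + 1))

lemma eta_eq (s : ℝ) (hs : 1 < s) :
    Real.Gamma s * (∑' k : ℕ, (-1 : ℝ) ^ k * ((k : ℝ) + 1) ^ (-s)) = etaI s := by
  have h := hasSum_mellin (ι := ℕ) (a := fun k => (-1 : ℂ) ^ k) (p := fun k => (k : ℝ) + 1)
    (F := fun x => ((1 / (Real.exp x + 1) : ℝ) : ℂ)) (s := (s : ℂ))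
    (fun i => Or.inr (by positivity)) (by simp; linarith) ?_ ?_
  · have e1 : mellin (fun x => ((1 / (Real.exp x + 1) : ℝ) : ℂ)) (s : ℂ) = ((etaI s : ℝ) : ℂ) := by
      unfold mellin etaI
      rw [← integral_complex_ofReal]
      refine setIntegral_congr_fun measurableSet_Ioi fun x hx => ?_
      simp only [smul_eq_mul]
      rw [Complex.ofReal_mul, Complex.ofReal_cpow (le_of_lt hx)]
      push_cast
      rfl
    have e2 : (fun i : ℕ => Complex.Gamma (s : ℂ) * (-1 : ℂ) ^ i / (((i : ℝ) + 1 : ℝ) : ℂ) ^ (s : ℂ))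
        = fun i : ℕ => ((Real.Gamma s * ((-1 : ℝ) ^ i * ((i : ℝ) + 1) ^ (-s)) : ℝ) : ℂ) := by
      funext i
      rw [Complex.Gamma_ofReal, ← Complex.ofReal_cpow (by positivity),
        Real.rpow_neg (by positivity)]
      push_cast
      ring
    rw [e1, e2] at h
    rw [← tsum_mul_left]
    exact (Complex.hasSum_ofReal.1 h).tsum_eq
  · intro t ht
    have ht : 0 < t := ht
    have h1 : Real.exp (-t) < 1 := by simpa using ht
    have := (hasSum_geometric_of_abs_lt_one (r := -Real.exp (-t))
      (by rwa [abs_neg, abs_of_pos (Real.exp_pos _)])).mul_left (Real.exp (-t))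
    have h2 := Complex.hasSum_ofReal.2 this
    convert h2 using 1
    · funext k
      have : Real.exp (-((k : ℝ) + 1) * t) = Real.exp (-t) * Real.exp (-t) ^ k := by
        rw [← Real.exp_nat_mul, ← Real.exp_add]; congr 1; ring
      rw [this]
      push_cast
      rw [neg_pow (Complex.exp _)]
      ring
    · congr 1
      have h3 : 1 - -Real.exp (-t) = (Real.exp t + 1) / Real.exp t := by
        rw [Real.exp_neg]; field_simp; ring
      rw [h3, Real.exp_neg]
      field_simp
  · have := (Real.summable_one_div_nat_add_rpow 1 s).2 hs
    refine this.congr fun n => ?_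
    rw [abs_of_pos (by positivity)]
    simp

lemma int_exp (r b : ℝ) (hr : 0 < r) (hb : 0 < b) :
    IntegrableOn (fun x => x ^ (r - 1) * Real.exp (-(b * x))) (Ioi 0) := by
  have := integrableOn_rpow_mul_exp_neg_mul_rpow (p := 1) (s := r - 1) (b := b)
    (by linarith) one_pos hb
  simpa using this

lemma int_f (r : ℝ) (hr : 0 < r) :
    IntegrableOn (fun x => x ^ (r - 1) * (1 / (Real.exp x + 1))) (Ioi 0) := by
  refine (int_exp r 1 hr one_pos).mono' (by fun_prop) ?_
  filter_upwards [ae_restrict_mem measurableSet_Ioi] with x hx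
  have hx : 0 < x := hx
  rw [Real.norm_of_nonneg (by positivity)]
  gcongr
  rw [one_mul, Real.exp_neg, one_div]
  gcongr
  linarith

lemma etaI_pos (r : ℝ) (hr : 0 < r) : 0 < etaI r := by
  have h : ∫ x in Ioi (0 : ℝ), (1 / 2) * (x ^ (r - 1) * Real.exp (-(1 * x))) ≤ etaI r := by
    refine setIntegral_mono_on ((int_exp r 1 hr one_pos).const_mul _) (int_f r hr)
      measurableSet_Ioi fun x hx => ?_
    have hx : 0 < x := hx
    have : 1 / 2 * Real.exp (-(1 * x)) ≤ 1 / (Real.exp x + 1) := by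
      have := Real.one_lt_exp_iff.2 hx
      rw [one_mul, Real.exp_neg, le_div_iff₀ (by positivity)]
      field_simp
      linarith
    have h2 := Real.rpow_pos_of_pos hx (r - 1)
    nlinarith
  rw [integral_const_mul, Real.integral_rpow_mul_exp_neg_mul_Ioi hr one_pos] at h
  have := Real.Gamma_pos_of_pos hr
  refine lt_of_lt_of_le ?_ h
  positivity

lemma key_set (A b : ℝ) (hA : 0 < A) : ∃ P : Set ℝ, OrdConnected P ∧ P ⊆ Ioi 0 ∧
    (P.Subsingleton → P = ∅) ∧
    ∀ x, 0 < x → (x ∈ P ↔ 0 < 1 / (Real.exp x + 1) - A * Real.exp (-(b * x))) := by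
  have hc : ∀ c : ℝ, ConvexOn ℝ (Ioi (0 : ℝ)) (fun x => Real.exp (c * x)) := by
    intro c
    have := convexOn_exp.comp_linearMap (LinearMap.mul ℝ ℝ c)
    exact this.subset (by simp) (convex_Ioi 0)
  have hcv : ConvexOn ℝ (Ioi (0 : ℝ)) (fun x => Real.exp (-b * x) + Real.exp ((1 - b) * x)) :=
    (hc _).add (hc _)
  have hconv := hcv.convex_lt (1 / A)
  refine ⟨_, hconv.ordConnected, fun x hx => hx.1, ?_, ?_⟩
  · intro hsub
    by_contra hne
    obtain ⟨x, hx⟩ := nonempty_iff_ne_empty.2 hne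
    have hop : IsOpen {x : ℝ | x ∈ Ioi (0 : ℝ) ∧
        Real.exp (-b * x) + Real.exp ((1 - b) * x) < 1 / A} :=
      isOpen_Ioi.inter (isOpen_lt
        (f := fun x : ℝ => Real.exp (-b * x) + Real.exp ((1 - b) * x)) (g := fun _ => 1 / A)
        (by fun_prop) (by fun_prop))
    rw [hsub.eq_singleton_of_mem hx] at hop
    exact not_isOpen_singleton x hop
  · intro x hx
    have e : Real.exp ((1 - b) * x) = Real.exp x * Real.exp (-(b * x)) := by
      rw [← Real.exp_add]; congr 1; ring
    simp only [mem_ofPred_eq, mem_Ioi, hx, true_and, e, neg_mul]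
    rw [sub_pos, lt_div_iff₀ hA, lt_div_iff₀ (by positivity)]
    constructor <;> intro h <;> linarith

lemma main_lt (s t a c : ℝ) (hs : 1 < s) (hst : s < t) (ha : 0 < a) (hc : 0 < c) (hac : a + c = 1) :
    (etaI s / Real.Gamma s) ^ a * (etaI t / Real.Gamma t) ^ c ≤
      etaI (a * s + c * t) / Real.Gamma (a * s + c * t) := by
  set u := a * s + c * t with hu
  have hsu : s < u := by nlinarith
  have hut : u < t := by nlinarith
  have hEs : 0 < etaI s / Real.Gamma s :=
    div_pos (etaI_pos s (by linarith)) (Real.Gamma_pos_of_pos (by linarith))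
  have hEt : 0 < etaI t / Real.Gamma t :=
    div_pos (etaI_pos t (by linarith)) (Real.Gamma_pos_of_pos (by linarith))
  obtain ⟨b, A, hb, hA, h1, h2⟩ : ∃ b A : ℝ, 0 < b ∧ 0 < A ∧
      etaI s / Real.Gamma s = A * (1 / b) ^ s ∧ etaI t / Real.Gamma t = A * (1 / b) ^ t := by
    generalize etaI s / Real.Gamma s = S at *
    generalize etaI t / Real.Gamma t = T at *
    have hts : t - s ≠ 0 := by linarith
    refine ⟨1 / (T / S) ^ (1 / (t - s)), S / ((T / S) ^ (1 / (t - s))) ^ s, by positivity,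
      by positivity, ?_, ?_⟩
    · rw [one_div_one_div]; field_simp
    · rw [one_div_one_div, div_mul_eq_mul_div, mul_div_assoc, ← Real.rpow_sub (by positivity),
        ← Real.rpow_mul (by positivity), one_div_mul_cancel hts, Real.rpow_one]
      field_simp
  have hI : ∀ r, 1 < r → IntegrableOn (fun x => x ^ (r - 1) *
      (1 / (Real.exp x + 1) - A * Real.exp (-(b * x)))) (Ioi 0) ∧
      ∫ x in Ioi (0 : ℝ), x ^ (r - 1) * (1 / (Real.exp x + 1) - A * Real.exp (-(b * x))) =
        etaI r - A * (1 / b) ^ r * Real.Gamma r := by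
    intro r hr
    have i1 := int_f r (by linarith)
    have i2 := (int_exp r b (by linarith) hb).const_mul A
    have e : (fun x : ℝ => x ^ (r - 1) * (1 / (Real.exp x + 1) - A * Real.exp (-(b * x)))) =
      fun x => x ^ (r - 1) * (1 / (Real.exp x + 1)) - A * (x ^ (r - 1) * Real.exp (-(b * x))) := by
      funext x; ring
    rw [e]
    refine ⟨i1.sub i2, ?_⟩
    rw [integral_sub i1 i2, integral_const_mul,
      Real.integral_rpow_mul_exp_neg_mul_Ioi (by linarith) hb]
    simp only [etaI]; ring
  obtain ⟨P, hP, hP0, hPs, hPx⟩ := key_set A b hA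
  obtain ⟨l, m, H⟩ := sep (u - s) (t - s) (by linarith) (by linarith) P hP hP0 hPs
  obtain ⟨is, Is⟩ := hI s hs
  obtain ⟨it, It⟩ := hI t (by linarith)
  obtain ⟨iu, Iu⟩ := hI u (by linarith)
  have gs := Real.Gamma_pos_of_pos (show 0 < s by linarith)
  have gt := Real.Gamma_pos_of_pos (show 0 < t by linarith)
  have gu := Real.Gamma_pos_of_pos (show 0 < u by linarith)
  have hle : ∫ x in Ioi (0 : ℝ), (l * (x ^ (s - 1) * (1 / (Real.exp x + 1) - A * Real.exp (-(b * x))))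
      + m * (x ^ (t - 1) * (1 / (Real.exp x + 1) - A * Real.exp (-(b * x))))) ≤
      ∫ x in Ioi (0 : ℝ), x ^ (u - 1) * (1 / (Real.exp x + 1) - A * Real.exp (-(b * x))) := by
    refine setIntegral_mono_on ((is.const_mul l).add (it.const_mul m)) iu measurableSet_Ioi
      fun x hx => ?_
    have hx : 0 < x := hx
    obtain ⟨H1, H2⟩ := H x hx
    have hPx := hPx x hx
    set D := 1 / (Real.exp x + 1) - A * Real.exp (-(b * x))
    have et : x ^ (t - 1) = x ^ (s - 1) * x ^ (t - s) := by
      rw [← Real.rpow_add hx]; congr 1; ring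
    have eu : x ^ (u - 1) = x ^ (s - 1) * x ^ (u - s) := by
      rw [← Real.rpow_add hx]; congr 1; ring
    have hp := Real.rpow_pos_of_pos hx (s - 1)
    have hD : 0 ≤ (x ^ (u - s) - (l + m * x ^ (t - s))) * D := by
      by_cases hxP : x ∈ P
      · exact mul_nonneg (sub_nonneg.2 (H1 hxP)) (hPx.1 hxP).le
      · exact mul_nonneg_of_nonpos_of_nonpos (sub_nonpos.2 (H2 hxP))
          (not_lt.1 fun h => hxP (hPx.2 h))
    have := mul_nonneg hp.le hD
    rw [et, eu]
    linarith
  rw [integral_add (is.const_mul l) (it.const_mul m), integral_const_mul, integral_const_mul,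
    Is, It, Iu, ← h1, ← h2, div_mul_cancel₀ _ gs.ne', div_mul_cancel₀ _ gt.ne'] at hle
  rw [h1, h2, le_div_iff₀ gu]
  have e : (A * (1 / b) ^ s) ^ a * (A * (1 / b) ^ t) ^ c = A * (1 / b) ^ u := by
    rw [Real.mul_rpow hA.le (by positivity), Real.mul_rpow hA.le (by positivity),
      ← Real.rpow_mul (by positivity), ← Real.rpow_mul (by positivity)]
    have e1 : A ^ a * A ^ c = A := by rw [← Real.rpow_add hA, hac, Real.rpow_one]
    have e2 : (1 / b) ^ (s * a) * (1 / b) ^ (t * c) = (1 / b) ^ u := by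
      rw [← Real.rpow_add (by positivity)]; congr 1; rw [hu]; ring
    rw [← e2]
    nth_rewrite 3 [← e1]
    ring
  rw [e]
  linarith

/-- Hölder-type inequality with alternating signs for harmonic-type series (inequality
(harm1) of the paper). The series are indexed so that `k + 1` ranges over `1, 2, 3, ...`. -/
theorem alternating_holder_harmonic (p q α β : ℝ) (hp : 1 < p) (hq : 1 < q)
    (hpq : 1 / p + 1 / q = 1) (hα : 0 < α) (hβ : 0 < β)
    (hqα : 1 < q * α) (hpβ : 1 < p * β) :
    (∑' k : ℕ, (-1 : ℝ) ^ k * ((k : ℝ) + 1) ^ (-(q * α))) ^ (1 / q) *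
      (∑' k : ℕ, (-1 : ℝ) ^ k * ((k : ℝ) + 1) ^ (-(p * β))) ^ (1 / p) ≤
    ∑' k : ℕ, (-1 : ℝ) ^ k * ((k : ℝ) + 1) ^ (-(α + β)) := by
  have hE : ∀ s : ℝ, 1 < s → (∑' k : ℕ, (-1 : ℝ) ^ k * ((k : ℝ) + 1) ^ (-s)) =
      etaI s / Real.Gamma s := by
    intro s hs
    have g := Real.Gamma_pos_of_pos (show 0 < s by linarith)
    rw [← eta_eq s hs]
    field_simp
  have hp0 : 0 < 1 / p := by positivity
  have hq0 : 0 < 1 / q := by positivity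
  have hu : 1 / q * (q * α) + 1 / p * (p * β) = α + β := by field_simp
  have h1 : 1 < α + β := by nlinarith
  rw [hE _ hqα, hE _ hpβ, hE _ h1]
  rcases lt_trichotomy (q * α) (p * β) with h | h | h
  · have := main_lt (q * α) (p * β) (1 / q) (1 / p) hqα h hq0 hp0 (by linarith)
    rwa [hu] at this
  · have hs : α + β = q * α := by
      rw [← hu, ← h, ← add_mul, add_comm (1 / q), hpq, one_mul]
    have hpos : 0 < etaI (q * α) / Real.Gamma (q * α) :=
      div_pos (etaI_pos _ (by linarith)) (Real.Gamma_pos_of_pos (by linarith))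
    rw [← h, hs, ← Real.rpow_add hpos, add_comm (1 / q), hpq, Real.rpow_one]
  · have := main_lt (p * β) (q * α) (1 / p) (1 / q) hpβ h hp0 hq0 hpq
    rw [add_comm, hu] at this
    rwa [mul_comm]
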